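/- Let 0 ≤ α < n, let σ and ω be positive locally finite Borel measures on ℝⁿ, and let 𝒟 be a dyadic grid. Then for every Q ∈ 𝒟: [Σ_{J ∈ 𝒟, J ⊆ Q} ‖Δ_J^ω x‖²_{L²(ω)} / ℓ(Q)²] · σ(Q) ≤ max{n,3} · A₂^{α,punct}(σ,ω) · |Q|^{2(1−α/n)}. Equivalently, the energy Muckenhoupt constant A₂^{α,energy}(σ,ω) := sup_{Q∈𝒟} [Σ_{J∈𝒟, J⊆Q} ‖Δ_J^ω x‖²_{L²(ω)} / ℓ(Q)²] · σ(Q)/|Q|^{2(1−α/n)} satisfies A₂^{α,energy}(σ,ω) ≤ max{n,3}·A₂^{α,punct}(σ,ω); symmetrically, with σ and ω interchanged, A₂^{α,*,energy}(σ,ω) ≤ max{n,3}·A₂^{α,*,punct}(σ,ω). -/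

import Mathlib

open MeasureTheory
open scoped ENNReal NNReal

noncomputable section

/-- An axis-parallel half-open cube in `ℝⁿ`, given by its corner `a` and side length `l`. -/
structure QCube (n : ℕ) where
  a : Fin n → ℝ
  l : ℝ

/-- The half-open cube as a subset of `ℝⁿ`. -/
def QCube.pts {n : ℕ} (Q : QCube n) : Set (EuclideanSpace ℝ (Fin n)) :=
  {x | ∀ i, Q.a i ≤ x i ∧ x i < Q.a i + Q.l}

/-- The dyadic child of a cube indexed by `e ∈ {0,1}ⁿ`. -/
def QCube.child {n : ℕ} (Q : QCube n) (e : Fin n → Bool) : QCube n :=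
  ⟨fun i => Q.a i + (if e i then Q.l / 2 else 0), Q.l / 2⟩

/-- The dyadic grid on `ℝⁿ` obtained by translating the standard grid by `t`. -/
def dyadicGrid {n : ℕ} (t : Fin n → ℝ) : Set (QCube n) :=
  {Q | ∃ (k : ℤ) (m : Fin n → ℤ),
    Q = ⟨fun i => t i + (2:ℝ) ^ (-k) * (m i : ℝ), (2:ℝ) ^ (-k)⟩}

/-- `E_S^μ f`, the `μ`-average of `f` over `S` (junk value `0` when `μ(S)` is `0` or `∞`). -/
def muAvg {n : ℕ} (μ : Measure (EuclideanSpace ℝ (Fin n)))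
    (S : Set (EuclideanSpace ℝ (Fin n))) (f : EuclideanSpace ℝ (Fin n) → ℝ) : ℝ :=
  (μ S).toReal⁻¹ * ∫ x in S, f x ∂μ

/-- The martingale difference `Δ_I^μ f = Σ_{I' child of I} 1_{I'} E_{I'}^μ f − 1_I E_I^μ f`. -/
def mdiff {n : ℕ} (μ : Measure (EuclideanSpace ℝ (Fin n))) (I : QCube n)
    (f : EuclideanSpace ℝ (Fin n) → ℝ) (x : EuclideanSpace ℝ (Fin n)) : ℝ :=
  (∑ e : Fin n → Bool,
      Set.indicator (I.child e).pts (fun _ => muAvg μ (I.child e).pts f) x)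
    - Set.indicator I.pts (fun _ => muAvg μ I.pts f) x

/-- `‖Δ_I^μ x‖²_{L²(μ)} = Σᵢ ∫ (Δ_I^μ xᵢ)² dμ`, for the identity map `x` of `ℝⁿ`. -/
def energyTerm {n : ℕ} (μ : Measure (EuclideanSpace ℝ (Fin n))) (I : QCube n) : ℝ≥0∞ :=
  ∑ i : Fin n, ∫⁻ x, ENNReal.ofReal ((mdiff μ I (fun z => z i) x) ^ 2) ∂μ

/-- `Σ_{J ∈ 𝒟, J ⊆ Q} ‖Δ_J^μ x‖²_{L²(μ)}`. -/
def energySum {n : ℕ} (t : Fin n → ℝ) (μ : Measure (EuclideanSpace ℝ (Fin n)))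
    (Q : QCube n) : ℝ≥0∞ :=
  ∑' J : {J : QCube n // J ∈ dyadicGrid t ∧ J.pts ⊆ Q.pts}, energyTerm μ (J : QCube n)

/-- The set of common atoms `𝔓_{(σ,ω)}` of two measures. -/
def commonAtoms {n : ℕ} (σ ω : Measure (EuclideanSpace ℝ (Fin n))) :
    Set (EuclideanSpace ℝ (Fin n)) :=
  {p | σ {p} ≠ 0 ∧ ω {p} ≠ 0}

/-- The punctured Muckenhoupt constant `A₂^{α,punct}(σ,ω)`, over all cubes. -/
def A2punctCubes (n : ℕ) (α : ℝ) (σ ω : Measure (EuclideanSpace ℝ (Fin n))) : ℝ≥0∞ :=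
  ⨆ (Q : QCube n) (_ : 0 < Q.l),
    (ω Q.pts - ⨆ p ∈ Q.pts ∩ commonAtoms σ ω, ω {p}) * σ Q.pts
      / (volume Q.pts) ^ (2 * (1 - α / (n : ℝ)))

/-- The dual punctured Muckenhoupt constant `A₂^{α,*,punct}(σ,ω)`, over all cubes. -/
def A2punctStarCubes (n : ℕ) (α : ℝ) (σ ω : Measure (EuclideanSpace ℝ (Fin n))) : ℝ≥0∞ :=
  ⨆ (Q : QCube n) (_ : 0 < Q.l),
    (σ Q.pts - ⨆ p ∈ Q.pts ∩ commonAtoms σ ω, σ {p}) * ω Q.pts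
      / (volume Q.pts) ^ (2 * (1 - α / (n : ℝ)))

theorem QCube.child_subset {n : ℕ} (Q : QCube n) (hl : 0 < Q.l) (e : Fin n → Bool) :
    (Q.child e).pts ⊆ Q.pts := by
  intro x hx i
  have := hx i
  simp only [QCube.child] at this
  split_ifs at this <;> constructor <;> linarith [this.1, this.2]

theorem QCube.measurableSet_pts {n : ℕ} (Q : QCube n) : MeasurableSet Q.pts := by
  have : Q.pts = ⋂ i, ({x | Q.a i ≤ x i} ∩ {x | x i < Q.a i + Q.l}) := by
    ext x; simp [QCube.pts]
  rw [this]
  refine MeasurableSet.iInter fun i => ?_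
  have hm : Measurable fun x : EuclideanSpace ℝ (Fin n) => x i := by fun_prop
  exact (measurableSet_le measurable_const hm).inter (measurableSet_lt hm measurable_const)

theorem QCube.pts_eq_iUnion_child {n : ℕ} (Q : QCube n) (hl : 0 < Q.l) :
    Q.pts = ⋃ e : Fin n → Bool, (Q.child e).pts := by
  apply Set.Subset.antisymm
  · intro x hx
    refine Set.mem_iUnion.2 ⟨fun i => decide (Q.a i + Q.l / 2 ≤ x i), fun i => ?_⟩
    have := hx i
    by_cases h : Q.a i + Q.l / 2 ≤ x i
    · simp only [QCube.child]
      rw [if_pos (by simpa using h)]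
      constructor <;> linarith [this.1, this.2]
    · simp only [QCube.child, h, decide_false]
      push Not at h
      constructor <;> simp <;> linarith [this.1, this.2]
  · exact Set.iUnion_subset fun e => Q.child_subset hl e

theorem QCube.child_disjoint {n : ℕ} (Q : QCube n) {e e' : Fin n → Bool} (h : e ≠ e') :
    Disjoint (Q.child e).pts (Q.child e').pts := by
  rw [Set.disjoint_left]
  intro x hx hx'
  apply h
  funext i
  have h1 := hx i
  have h2 := hx' i
  simp only [QCube.child] at h1 h2
  cases he : e i <;> cases he' : e' i <;> simp [he, he'] at h1 h2 ⊢ <;> linarith [h1.1, h1.2, h2.1, h2.2]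

theorem QCube.isBounded_pts {n : ℕ} (Q : QCube n) : Bornology.IsBounded Q.pts := by
  have h : Bornology.IsBounded (Set.Icc Q.a (fun i => Q.a i + Q.l)) := Metric.isBounded_Icc _ _
  have h2 := (PiLp.antilipschitzWith_ofLp 2 (fun _ : Fin n => ℝ)).isBounded_preimage h
  refine h2.subset ?_
  intro x hx
  exact ⟨fun i => (hx i).1, fun i => (hx i).2.le⟩

theorem QCube.measure_ne_top {n : ℕ} (Q : QCube n) (μ : Measure (EuclideanSpace ℝ (Fin n)))
    [IsLocallyFiniteMeasure μ] : μ Q.pts ≠ ∞ :=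
  Q.isBounded_pts.measure_lt_top.ne

theorem QCube.volume_ne_zero {n : ℕ} (Q : QCube n) (hl : 0 < Q.l) : volume Q.pts ≠ 0 := by
  have ho : IsOpen {x : EuclideanSpace ℝ (Fin n) | ∀ i, Q.a i < x i ∧ x i < Q.a i + Q.l} := by
    simp only [Set.ofPred_forall]
    refine isOpen_iInter_of_finite fun i => ?_
    have hc : Continuous fun x : EuclideanSpace ℝ (Fin n) => x i := by fun_prop
    exact (isOpen_lt continuous_const hc).inter (isOpen_lt hc continuous_const)
  have hne : {x : EuclideanSpace ℝ (Fin n) | ∀ i, Q.a i < x i ∧ x i < Q.a i + Q.l}.Nonempty :=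
    ⟨WithLp.toLp 2 fun i => Q.a i + Q.l / 2, fun i => by
      constructor <;> simp <;> linarith⟩
  have hpos := ho.measure_pos volume hne
  have hsub : {x : EuclideanSpace ℝ (Fin n) | ∀ i, Q.a i < x i ∧ x i < Q.a i + Q.l} ⊆ Q.pts :=
    fun x hx i => ⟨(hx i).1.le, (hx i).2⟩
  exact (hpos.trans_le (measure_mono hsub)).ne'

theorem QCube.integrableOn {n : ℕ} (Q : QCube n) (μ : Measure (EuclideanSpace ℝ (Fin n)))
    [IsLocallyFiniteMeasure μ] {f : EuclideanSpace ℝ (Fin n) → ℝ} (hf : Continuous f) :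
    IntegrableOn f Q.pts μ :=
  (hf.continuousOn.integrableOn_compact
    (Q.isBounded_pts.isCompact_closure)).mono_set subset_closure

/-- Pythagoras on one cube. -/
theorem QCube.pyth {n : ℕ} (Q : QCube n) (μ : Measure (EuclideanSpace ℝ (Fin n)))
    [IsLocallyFiniteMeasure μ] {f : EuclideanSpace ℝ (Fin n) → ℝ} (hf : Continuous f) (b : ℝ) :
    ∫⁻ x in Q.pts, ENNReal.ofReal ((f x - b) ^ 2) ∂μ
      = ∫⁻ x in Q.pts, ENNReal.ofReal ((f x - muAvg μ Q.pts f) ^ 2) ∂μ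
        + ENNReal.ofReal ((muAvg μ Q.pts f - b) ^ 2) * μ Q.pts := by
  by_cases h0 : μ Q.pts = 0
  · simp [Measure.restrict_eq_zero.2 h0, h0]
  set m := muAvg μ Q.pts f with hm
  have hfin := Q.measure_ne_top μ
  have hr : (μ Q.pts).toReal ≠ 0 := ENNReal.toReal_ne_zero.2 ⟨h0, hfin⟩
  have hint : ∫ x in Q.pts, f x ∂μ = (μ Q.pts).toReal * m := by
    rw [hm, muAvg, mul_inv_cancel_left₀ hr]
  rw [← ofReal_integral_eq_lintegral_ofReal (Q.integrableOn μ (by fun_prop))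
      (Filter.Eventually.of_forall fun x => sq_nonneg _),
    ← ofReal_integral_eq_lintegral_ofReal (Q.integrableOn μ (by fun_prop))
      (Filter.Eventually.of_forall fun x => sq_nonneg _)]
  conv_rhs => rw [← ENNReal.ofReal_toReal hfin]
  rw [← ENNReal.ofReal_mul (sq_nonneg _), ← ENNReal.ofReal_add
    (integral_nonneg fun x => sq_nonneg _) (by positivity)]
  congr 1
  have e1 : ∀ x, (f x - b) ^ 2 = (f x - m) ^ 2 + (2 * (m - b) * f x + (b ^ 2 - m ^ 2)) := by
    intro x; ring
  simp_rw [e1]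
  rw [integral_add (Q.integrableOn μ (by fun_prop)) (Q.integrableOn μ (by fun_prop)),
    integral_add (Q.integrableOn μ (by fun_prop)) (Q.integrableOn μ (by fun_prop)),
    integral_const_mul, hint]
  simp [Measure.real]
  ring

/-- The variance. -/
def variance' {n : ℕ} (μ : Measure (EuclideanSpace ℝ (Fin n))) (Q : QCube n) : ℝ≥0∞ :=
  ∑ i : Fin n, ∫⁻ x in Q.pts, ENNReal.ofReal ((x i - muAvg μ Q.pts (fun z => z i)) ^ 2) ∂μ

theorem lintegral_eq_sum_child {n : ℕ} (μ : Measure (EuclideanSpace ℝ (Fin n))) (Q : QCube n)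
    (hl : 0 < Q.l) (g : EuclideanSpace ℝ (Fin n) → ℝ≥0∞) :
    ∫⁻ x in Q.pts, g x ∂μ = ∑ e : Fin n → Bool, ∫⁻ x in (Q.child e).pts, g x ∂μ := by
  rw [Q.pts_eq_iUnion_child hl, lintegral_iUnion (fun e => (Q.child e).measurableSet_pts)
    (fun e e' h => Q.child_disjoint h), tsum_fintype]

theorem mdiff_of_mem {n : ℕ} (μ : Measure (EuclideanSpace ℝ (Fin n))) (Q : QCube n)
    (hl : 0 < Q.l) (f : EuclideanSpace ℝ (Fin n) → ℝ) (e : Fin n → Bool)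
    {x : EuclideanSpace ℝ (Fin n)} (hx : x ∈ (Q.child e).pts) :
    mdiff μ Q f x = muAvg μ (Q.child e).pts f - muAvg μ Q.pts f := by
  unfold mdiff
  rw [Set.indicator_of_mem (Q.child_subset hl e hx), Finset.sum_eq_single e]
  · rw [Set.indicator_of_mem hx]
  · intro e' _ h
    exact Set.indicator_of_notMem (fun hx' => Set.disjoint_left.1 (Q.child_disjoint h) hx' hx) _
  · simp

theorem mdiff_of_notMem {n : ℕ} (μ : Measure (EuclideanSpace ℝ (Fin n))) (Q : QCube n)
    (hl : 0 < Q.l) (f : EuclideanSpace ℝ (Fin n) → ℝ)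
    {x : EuclideanSpace ℝ (Fin n)} (hx : x ∉ Q.pts) :
    mdiff μ Q f x = 0 := by
  unfold mdiff
  rw [Set.indicator_of_notMem hx, Finset.sum_eq_zero, sub_zero]
  intro e _
  exact Set.indicator_of_notMem (fun hx' => hx (Q.child_subset hl e hx')) _

theorem variance_eq {n : ℕ} (μ : Measure (EuclideanSpace ℝ (Fin n)))
    [IsLocallyFiniteMeasure μ] (Q : QCube n) (hl : 0 < Q.l) :
    variance' μ Q = energyTerm μ Q + ∑ e : Fin n → Bool, variance' μ (Q.child e) := by
  unfold variance' energyTerm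
  rw [Finset.sum_comm, ← Finset.sum_add_distrib]
  refine Finset.sum_congr rfl fun i _ => ?_
  have h1 : ∫⁻ x, ENNReal.ofReal ((mdiff μ Q (fun z => z i) x) ^ 2) ∂μ
      = ∫⁻ x in Q.pts, ENNReal.ofReal ((mdiff μ Q (fun z => z i) x) ^ 2) ∂μ := by
    rw [← lintegral_indicator Q.measurableSet_pts]
    congr 1
    funext x
    by_cases hx : x ∈ Q.pts
    · rw [Set.indicator_of_mem hx]
    · rw [Set.indicator_of_notMem hx, mdiff_of_notMem μ Q hl _ hx]; simp
  rw [h1, lintegral_eq_sum_child μ Q hl, lintegral_eq_sum_child μ Q hl, ← Finset.sum_add_distrib]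
  refine Finset.sum_congr rfl fun e _ => ?_
  have hf : Continuous fun z : EuclideanSpace ℝ (Fin n) => z i := by fun_prop
  rw [(Q.child e).pyth μ hf, add_comm]
  congr 1
  rw [← setLIntegral_const]
  refine setLIntegral_congr_fun (Q.child e).measurableSet_pts fun x hx => ?_
  simp only
  rw [mdiff_of_mem μ Q hl _ e hx]

theorem grid_pos {n : ℕ} {t : Fin n → ℝ} {Q : QCube n} (h : Q ∈ dyadicGrid t) : 0 < Q.l := by
  obtain ⟨k, m, rfl⟩ := h
  simp only; positivity

theorem child_mem_grid {n : ℕ} {t : Fin n → ℝ} {Q : QCube n} (h : Q ∈ dyadicGrid t)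
    (e : Fin n → Bool) : Q.child e ∈ dyadicGrid t := by
  obtain ⟨k, m, rfl⟩ := h
  have h2 : (2:ℝ) ^ (-k) / 2 = 2 ^ (-(k + 1)) := by
    rw [neg_add, zpow_add₀ two_ne_zero]; norm_num; ring
  have h3 : (2:ℝ) ^ (-k) = 2 * 2 ^ (-(k + 1)) := by linarith
  refine ⟨k + 1, fun i => 2 * m i + if e i then 1 else 0, ?_⟩
  simp only [QCube.child, QCube.mk.injEq]
  refine ⟨?_, h2⟩
  funext i
  rw [h2, h3]
  split_ifs <;> push_cast <;> ring

theorem subset_bounds {n : ℕ} {J Q : QCube n} (hJ : 0 < J.l) (h : J.pts ⊆ Q.pts) (i : Fin n) :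
    Q.a i ≤ J.a i ∧ J.a i + J.l ≤ Q.a i + Q.l := by
  constructor
  · have hm : (WithLp.toLp 2 J.a : EuclideanSpace ℝ (Fin n)) ∈ J.pts := fun j => by
      simp [hJ]
    exact (h hm i).1
  · by_contra! hc
    set s := max 0 (Q.a i + Q.l - J.a i) with hs
    have hs0 : 0 ≤ s := le_max_left _ _
    have hs1 : s < J.l := max_lt hJ (by linarith)
    have hm : (WithLp.toLp 2 (fun j => J.a j + s) : EuclideanSpace ℝ (Fin n)) ∈ J.pts :=
      fun j => by simp [hs0, hs1]
    have := (h hm i).2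
    simp only at this
    linarith [le_max_right 0 (Q.a i + Q.l - J.a i)]

theorem grid_nested {n : ℕ} (hn : 1 ≤ n) {t : Fin n → ℝ} {J Q : QCube n}
    (hJ : J ∈ dyadicGrid t) (hQ : Q ∈ dyadicGrid t) (h : J.pts ⊆ Q.pts) :
    J = Q ∨ ∃ e, J.pts ⊆ (Q.child e).pts := by
  have hJl := grid_pos hJ
  have hb := subset_bounds hJl h
  obtain ⟨k, m, rfl⟩ := hQ
  obtain ⟨k', m', rfl⟩ := hJ
  simp only at hb hJl
  have hle : (2:ℝ) ^ (-k') ≤ 2 ^ (-k) := by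
    have := hb ⟨0, hn⟩; linarith [this.1, this.2]
  have hkk : -k' ≤ -k := (zpow_le_zpow_iff_right₀ (by norm_num)).1 hle
  rcases eq_or_lt_of_le hkk with heq | hlt
  · left
    rw [heq] at hb ⊢
    simp only [QCube.mk.injEq, and_true]
    funext i
    have := hb i; linarith [this.1, this.2]
  · right
    obtain ⟨d, hd⟩ : ∃ d : ℕ, k' = k + 1 + d := ⟨(k' - k - 1).toNat, by omega⟩
    set r : ℝ := 2 ^ (-k') with hr
    have hk : (2:ℝ) ^ (-k) / 2 = 2 ^ d * r := by
      rw [hr, hd, div_eq_iff two_ne_zero, ← zpow_natCast, ← zpow_add₀ two_ne_zero,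
        ← zpow_add_one₀ two_ne_zero]
      congr 1; ring
    refine ⟨fun i => decide (2 ^ d * (2 * m i + 1) ≤ m' i), fun x hx i => ?_⟩
    have h1 := hx i
    have h2 := h hx i
    simp only [QCube.child] at h1 h2 ⊢
    have hk2 : (2:ℝ) ^ (-k) = 2 * (2 ^ d * r) := by linarith
    rw [hk]
    rw [hk2] at h2 ⊢
    by_cases hc : 2 ^ d * (2 * m i + 1) ≤ m' i
    · have hc' : (2:ℝ) ^ d * (2 * m i + 1) ≤ m' i := by exact_mod_cast hc
      have := mul_le_mul_of_nonneg_left hc' hJl.le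
      simp only [hc, decide_true, if_true]
      constructor <;> nlinarith [h1.1, h1.2, h2.1, h2.2]
    · have hc' : (m' i : ℝ) + 1 ≤ (2:ℝ) ^ d * (2 * m i + 1) := by
        have : m' i + 1 ≤ 2 ^ d * (2 * m i + 1) := by omega
        exact_mod_cast this
      have := mul_le_mul_of_nonneg_left hc' hJl.le
      simp only [hc, decide_false]
      constructor <;> simp <;> nlinarith [h1.1, h1.2, h2.1, h2.2]

theorem sum_biUnion_le_aux {ι κ : Type*} [DecidableEq ι] [DecidableEq κ] (s : Finset ι)
    (T : ι → Finset κ) (f : κ → ℝ≥0∞) :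
    ∑ x ∈ (s.biUnion T), f x ≤ ∑ i ∈ s, ∑ x ∈ T i, f x := by
  induction s using Finset.induction_on with
  | empty => simp
  | insert a s ha ih =>
    rw [Finset.biUnion_insert, Finset.sum_insert ha]
    refine le_trans ?_ (add_le_add le_rfl ih)
    rw [← Finset.sum_union_inter]
    exact le_self_add

theorem finset_bound {n : ℕ} (hn : 1 ≤ n) (t : Fin n → ℝ)
    (μ : Measure (EuclideanSpace ℝ (Fin n))) [IsLocallyFiniteMeasure μ] (N : ℕ) :
    ∀ (Q : QCube n), Q ∈ dyadicGrid t → ∀ S : Finset (QCube n),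
      (∀ J ∈ S, J ∈ dyadicGrid t ∧ J.pts ⊆ Q.pts ∧ Q.l / 2 ^ N < J.l) →
      ∑ J ∈ S, energyTerm μ J ≤ variance' μ Q := by
  classical
  induction N with
  | zero =>
    intro Q hQ S hS
    have : S = ∅ := by
      refine Finset.eq_empty_of_forall_notMem fun J hJ => ?_
      obtain ⟨h1, h2, h3⟩ := hS J hJ
      have := subset_bounds (grid_pos h1) h2 ⟨0, hn⟩
      simp at h3
      linarith [this.1, this.2]
    simp [this]
  | succ N ih =>
    intro Q hQ S hS
    rw [variance_eq μ Q (grid_pos hQ)]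
    have hsub : S ⊆ {Q} ∪ Finset.univ.biUnion
        (fun e : Fin n → Bool => S.filter fun J => J.pts ⊆ (Q.child e).pts) := by
      intro J hJ
      obtain ⟨h1, h2, h3⟩ := hS J hJ
      rcases grid_nested hn h1 hQ h2 with rfl | ⟨e, he⟩
      · simp
      · simp only [Finset.mem_union, Finset.mem_biUnion, Finset.mem_filter]
        exact Or.inr ⟨e, Finset.mem_univ _, hJ, he⟩
    calc ∑ J ∈ S, energyTerm μ J
        ≤ ∑ J ∈ ({Q} ∪ Finset.univ.biUnion
        (fun e : Fin n → Bool => S.filter fun J => J.pts ⊆ (Q.child e).pts)), energyTerm μ J :=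
          Finset.sum_le_sum_of_subset hsub
      _ ≤ ∑ J ∈ {Q}, energyTerm μ J + ∑ J ∈ (Finset.univ.biUnion
        (fun e : Fin n → Bool => S.filter fun J => J.pts ⊆ (Q.child e).pts)), energyTerm μ J := by
          rw [← Finset.sum_union_inter]; exact le_self_add
      _ ≤ energyTerm μ Q + ∑ e : Fin n → Bool,
            ∑ J ∈ (S.filter (fun J => J.pts ⊆ (Q.child e).pts)), energyTerm μ J := by
          rw [Finset.sum_singleton]
          gcongr
          exact sum_biUnion_le_aux _ _ _
      _ ≤ _ := by
          gcongr with e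
          refine ih _ (child_mem_grid hQ e) _ fun J hJ => ?_
          obtain ⟨hJS, hJe⟩ := Finset.mem_filter.1 hJ
          obtain ⟨h1, h2, h3⟩ := hS J hJS
          refine ⟨h1, hJe, ?_⟩
          simp only [QCube.child]
          rwa [div_div, ← pow_succ']

theorem energySum_le_variance {n : ℕ} (hn : 1 ≤ n) (t : Fin n → ℝ)
    (μ : Measure (EuclideanSpace ℝ (Fin n))) [IsLocallyFiniteMeasure μ]
    (Q : QCube n) (hQ : Q ∈ dyadicGrid t) : energySum t μ Q ≤ variance' μ Q := by
  classical
  unfold energySum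
  refine ENNReal.summable.tsum_le_of_sum_le fun S => ?_
  have hN : ∃ N : ℕ, ∀ J ∈ S, Q.l / 2 ^ N < (J : QCube n).l := by
    have : ∀ᶠ N : ℕ in Filter.atTop, ∀ J ∈ S, Q.l / 2 ^ N < (J : QCube n).l := by
      rw [Filter.eventually_all_finset]
      intro J _
      have ht : Filter.Tendsto (fun N : ℕ => Q.l / 2 ^ N) Filter.atTop (nhds 0) :=
        tendsto_const_nhds.div_atTop (tendsto_pow_atTop_atTop_of_one_lt (by norm_num))
      exact ht.eventually_lt_const (grid_pos J.2.1)
    exact this.exists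
  obtain ⟨N, hN⟩ := hN
  have := finset_bound hn t μ N Q hQ (S.map (Function.Embedding.subtype _)) (by
    intro J hJ
    obtain ⟨J', hJ', rfl⟩ := Finset.mem_map.1 hJ
    exact ⟨J'.2.1, J'.2.2, hN J' hJ'⟩)
  rwa [Finset.sum_map] at this

theorem variance_le {n : ℕ} (μ : Measure (EuclideanSpace ℝ (Fin n))) [IsLocallyFiniteMeasure μ]
    (Q : QCube n) (p : EuclideanSpace ℝ (Fin n)) (hp : p ∈ Q.pts) :
    variance' μ Q ≤ n * ENNReal.ofReal (Q.l ^ 2) * (μ Q.pts - μ {p}) := by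
  unfold variance'
  have key : ∀ i : Fin n,
      ∫⁻ x in Q.pts, ENNReal.ofReal ((x i - muAvg μ Q.pts (fun z => z i)) ^ 2) ∂μ
        ≤ ENNReal.ofReal (Q.l ^ 2) * (μ Q.pts - μ {p}) := by
    intro i
    have hf : Continuous fun z : EuclideanSpace ℝ (Fin n) => z i := by fun_prop
    refine (le_self_add.trans (Q.pyth μ hf (p i)).ge).trans ?_
    have hd : μ Q.pts - μ {p} = μ (Q.pts \ {p}) :=
      (measure_sdiff (Set.singleton_subset_iff.2 hp) (measurableSet_singleton p).nullMeasurableSet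
        (ne_top_of_le_ne_top (Q.measure_ne_top μ)
          (measure_mono (Set.singleton_subset_iff.2 hp)))).symm
    rw [hd, ← setLIntegral_const,
      ← lintegral_indicator Q.measurableSet_pts,
      ← lintegral_indicator (Q.measurableSet_pts.diff (measurableSet_singleton p))]
    refine lintegral_mono fun x => ?_
    by_cases hx : x ∈ Q.pts
    · by_cases hxp : x = p
      · subst hxp; simp
      · rw [Set.indicator_of_mem hx, Set.indicator_of_mem (show x ∈ Q.pts \ {p} from ⟨hx, hxp⟩)]
        apply ENNReal.ofReal_le_ofReal
        have h1 := hx i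
        have h2 := hp i
        apply sq_le_sq'  <;> linarith [h1.1, h1.2, h2.1, h2.2]
    · rw [Set.indicator_of_notMem hx]; exact zero_le
  refine (Finset.sum_le_sum fun i _ => key i).trans ?_
  simp [mul_assoc]

theorem energy_div_le {n : ℕ} (hn : 1 ≤ n) (t : Fin n → ℝ)
    (μ : Measure (EuclideanSpace ℝ (Fin n))) [IsLocallyFiniteMeasure μ]
    (Q : QCube n) (hQ : Q ∈ dyadicGrid t) (P : Set (EuclideanSpace ℝ (Fin n))) :
    energySum t μ Q / ENNReal.ofReal (Q.l ^ 2)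
      ≤ n * (μ Q.pts - ⨆ p ∈ Q.pts ∩ P, μ {p}) := by
  have hl := grid_pos hQ
  have hb : ∀ p ∈ Q.pts, energySum t μ Q / ENNReal.ofReal (Q.l ^ 2)
      ≤ n * (μ Q.pts - μ {p}) := by
    intro p hp
    refine ENNReal.div_le_of_le_mul ?_
    refine ((energySum_le_variance hn t μ Q hQ).trans (variance_le μ Q p hp)).trans (le_of_eq ?_)
    ring
  have hp0 : (WithLp.toLp 2 Q.a : EuclideanSpace ℝ (Fin n)) ∈ Q.pts := fun j => by simp [hl]
  rw [ENNReal.sub_iSup (Q.measure_ne_top μ), ENNReal.mul_iInf_of_ne (by simp; omega) (by simp)]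
  refine le_iInf fun p => ?_
  by_cases hp : p ∈ Q.pts ∩ P
  · simpa [hp] using hb p hp.1
  · simp only [hp, not_false_eq_true, iSup_neg, bot_eq_zero, tsub_zero]
    exact (hb _ hp0).trans (by gcongr; exact tsub_le_self)

theorem main_bound {n : ℕ} (hn : 1 ≤ n) (t : Fin n → ℝ) (s : ℝ)
    (σ ω : Measure (EuclideanSpace ℝ (Fin n))) [IsLocallyFiniteMeasure ω]
    (P : Set (EuclideanSpace ℝ (Fin n))) (Q : QCube n) (hQ : Q ∈ dyadicGrid t) :
    energySum t ω Q / ENNReal.ofReal (Q.l ^ 2) * σ Q.pts / (volume Q.pts) ^ s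
      ≤ ((max n 3 : ℕ) : ℝ≥0∞) * ⨆ (Q : QCube n) (_ : 0 < Q.l),
        (ω Q.pts - ⨆ p ∈ Q.pts ∩ P, ω {p}) * σ Q.pts / (volume Q.pts) ^ s := by
  refine le_trans ?_ (mul_le_mul_right (le_iSup₂_of_le Q (grid_pos hQ) le_rfl) _)
  rw [← mul_div_assoc, ← mul_assoc]
  gcongr
  refine (energy_div_le hn t ω Q hQ P).trans ?_
  gcongr
  exact le_max_left _ _

/-- The energy Muckenhoupt constant is controlled by the punctured
Muckenhoupt constant: for every dyadic cube `Q`,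
`[Σ_{J⊆Q} ‖Δ_J^ω x‖² / ℓ(Q)²] σ(Q) ≤ max{n,3} A₂^{α,punct}(σ,ω) |Q|^{2(1−α/n)}`;
equivalently `A₂^{α,energy} ≤ max{n,3} A₂^{α,punct}`, and symmetrically
`A₂^{α,*,energy} ≤ max{n,3} A₂^{α,*,punct}`. -/
theorem statement6 (n : ℕ) (α : ℝ) (hn : 1 ≤ n) (hα0 : 0 ≤ α) (hαn : α < n)
    (σ ω : Measure (EuclideanSpace ℝ (Fin n)))
    (hσ : IsLocallyFiniteMeasure σ) (hω : IsLocallyFiniteMeasure ω)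
    (t : Fin n → ℝ) :
    (∀ Q ∈ dyadicGrid t,
      energySum t ω Q / ENNReal.ofReal (Q.l ^ 2) * σ Q.pts
        ≤ ((max n 3 : ℕ) : ℝ≥0∞) * A2punctCubes n α σ ω
            * (volume Q.pts) ^ (2 * (1 - α / (n : ℝ)))) ∧
    (⨆ Q ∈ dyadicGrid t,
        energySum t ω Q / ENNReal.ofReal (Q.l ^ 2) * σ Q.pts
          / (volume Q.pts) ^ (2 * (1 - α / (n : ℝ))))
      ≤ ((max n 3 : ℕ) : ℝ≥0∞) * A2punctCubes n α σ ω ∧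
    (⨆ Q ∈ dyadicGrid t,
        energySum t σ Q / ENNReal.ofReal (Q.l ^ 2) * ω Q.pts
          / (volume Q.pts) ^ (2 * (1 - α / (n : ℝ))))
      ≤ ((max n 3 : ℕ) : ℝ≥0∞) * A2punctStarCubes n α σ ω := by
  have h1 : ∀ Q ∈ dyadicGrid t, energySum t ω Q / ENNReal.ofReal (Q.l ^ 2) * σ Q.pts
      / (volume Q.pts) ^ (2 * (1 - α / (n : ℝ)))
      ≤ ((max n 3 : ℕ) : ℝ≥0∞) * A2punctCubes n α σ ω := fun Q hQ =>
    main_bound hn t _ σ ω (commonAtoms σ ω) Q hQ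
  refine ⟨fun Q hQ => ?_, iSup₂_le h1, iSup₂_le fun Q hQ =>
    main_bound hn t _ ω σ (commonAtoms σ ω) Q hQ⟩
  have hv0 := Q.volume_ne_zero (grid_pos hQ)
  have hvt := Q.measure_ne_top volume
  have h0 : (volume Q.pts) ^ (2 * (1 - α / (n : ℝ))) ≠ 0 :=
    (ENNReal.rpow_pos (pos_iff_ne_zero.2 hv0) hvt).ne'
  have ht : (volume Q.pts) ^ (2 * (1 - α / (n : ℝ))) ≠ ∞ :=
    ENNReal.rpow_ne_top_of_ne_zero hv0 hvt
  exact (ENNReal.div_le_iff h0 ht).1 (h1 Q hQ)
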